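/- Let u_0 ∈ L^1(ℝ^d) and M = ∫_{ℝ^d} u_0(x) dx. Then for every p ∈ [1,∞], lim_{t→∞} t^{d(1−1/p)/α} ‖P_t u_0(·) − M p(t,·)‖_{L^p(ℝ^d)} = 0. -/

import Mathlib

open MeasureTheory Real Filter
open scoped ENNReal RealInnerProductSpace

/-- The `α`-stable heat kernel `p(t,x) = (2π)^{-d} ∫ e^{-i x·ξ} e^{-t|ξ|^α} dξ` on `ℝ^d`
(the integral is real by symmetry, so we write it with a cosine). -/
noncomputable def heatKer (d : ℕ) (α : ℝ) (t : ℝ) (x : EuclideanSpace ℝ (Fin d)) : ℝ :=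
  (2 * Real.pi) ^ (-(d : ℝ)) *
    ∫ ξ : EuclideanSpace ℝ (Fin d), Real.cos ⟪x, ξ⟫ * Real.exp (-t * ‖ξ‖ ^ α)

/-- The stable semigroup `P_t f(x) = ∫ p(t, x−y) f(y) dy`. -/
noncomputable def heatSg (d : ℕ) (α t : ℝ) (f : EuclideanSpace ℝ (Fin d) → ℝ)
    (x : EuclideanSpace ℝ (Fin d)) : ℝ :=
  ∫ y, heatKer d α t (x - y) * f y


theorem sibuya {β : ℝ} (h0 : 0 < β) (h1 : β < 1) : ∃ a : ℕ → ℝ, (∀ k, 0 ≤ a k) ∧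
    ∀ z : ℝ, 0 ≤ z → z < 1 → HasSum (fun k => a k * z ^ k) (1 - (1 - z) ^ β) := by
  have hrec : ∀ k, (-1 : ℝ) ^ k * Ring.choose β (k + 1) ≥ 0 := by
    intro k
    induction k with
    | zero => simp [h0.le]
    | succ k ih =>
      have := Ring.choose_eq_smul (a := β) (n := k + 1)
      have h2 := Ring.choose_eq_smul (a := β) (n := k + 1 + 1)
      have h3 : Ring.choose β (k + 1 + 1) * (k + 2) = Ring.choose β (k + 1) * (β - (k + 1)) := by
        rw [h2, this, descPochhammer_succ_right, Polynomial.smeval_mul, Polynomial.smeval_sub,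
          Polynomial.smeval_X, Polynomial.smeval_natCast, Nat.factorial_succ (k + 1)]
        have : ((k + 1).factorial : ℝ) ≠ 0 := by positivity
        simp only [smul_eq_mul, pow_one, pow_zero, nsmul_eq_mul, mul_one]
        push_cast
        field_simp
        ring
      have h4 : (-1 : ℝ) ^ (k + 1) * Ring.choose β (k + 1 + 1) = ((-1 : ℝ) ^ k * Ring.choose β (k + 1)) * ((k + 1 - β) / (k + 2)) := by
        field_simp
        rw [pow_succ]
        linear_combination (-(-1) ^ k) * h3
      rw [h4]
      apply mul_nonneg ih
      apply div_nonneg <;> [skip; positivity]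
      have : (0:ℝ) ≤ k := by positivity
      linarith
  refine ⟨fun k => if k = 0 then 0 else - ((-1) ^ k * Ring.choose β k), ?_, ?_⟩
  · intro k
    rcases k with _ | k
    · simp
    · have := hrec k
      simp only [Nat.add_eq_zero_iff, one_ne_zero, and_false, if_false, pow_succ]
      linarith
  · intro z hz hz1
    have := (Real.one_add_rpow_hasFPowerSeriesOnBall_zero (a := β)).hasSum (y := -z) (by
      simp [abs_of_nonneg hz, hz1, Real.enorm_eq_ofReal_abs])
    simp only [binomialSeries_apply, List.ofFn_const, List.prod_replicate, zero_add, smul_eq_mul] at this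
    have h5 := (hasSum_ite_eq (0:ℕ) (1:ℝ)).sub this
    rw [← sub_eq_add_neg] at h5
    suffices h : ∀ k, (if k = 0 then (1 : ℝ) else 0) - Ring.choose β k * (-z) ^ k =
        (if k = 0 then 0 else - ((-1) ^ k * Ring.choose β k)) * z ^ k by
      simp_rw [h] at h5
      exact h5
    intro k
    by_cases hk : k = 0
    · simp [hk]
    · simp only [hk, if_false, neg_pow z]
      ring

abbrev EE (d : ℕ) := EuclideanSpace ℝ (Fin d)

theorem gauss_int {d : ℕ} {δ : ℝ} (hδ : 0 < δ) :
    Integrable (fun ξ : EE d => Real.exp (-δ * ‖ξ‖ ^ 2)) := by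
  have := (GaussianFourier.integrable_cexp_neg_mul_sq_norm_add (V := EE d) (b := (δ : ℂ))
    (by simpa using hδ) 0 0).norm
  refine this.congr (Eventually.of_forall fun ξ => ?_)
  simp only [Complex.norm_exp]
  congr 1
  simp [← Complex.ofReal_pow]

theorem gauss_cos {d : ℕ} {δ : ℝ} (hδ : 0 < δ) (x : EE d) :
    ∫ ξ : EE d, Real.cos ⟪x, ξ⟫ * Real.exp (-δ * ‖ξ‖ ^ 2) =
      (π / δ) ^ ((d : ℝ) / 2) * Real.exp (-‖x‖ ^ 2 / (4 * δ)) := by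
  have h := GaussianFourier.integral_cexp_neg_mul_sq_norm_add (V := EE d) (b := (δ : ℂ))
    (by simpa using hδ) Complex.I x
  have hi := GaussianFourier.integrable_cexp_neg_mul_sq_norm_add (V := EE d) (b := (δ : ℂ))
    (by simpa using hδ) Complex.I x
  have h2 := congrArg Complex.re h
  rw [← RCLike.re_eq_complex_re, ← integral_re hi] at h2
  convert h2 using 1
  · refine integral_congr_ae (Eventually.of_forall fun ξ => ?_)
    simp only [RCLike.re_eq_complex_re]
    rw [Complex.exp_re]
    have h3 : (-(δ : ℂ) * (‖ξ‖ : ℂ) ^ 2 + Complex.I * (⟪x, ξ⟫ : ℂ)) =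
      ((-δ * ‖ξ‖ ^ 2 : ℝ) : ℂ) + (⟪x, ξ⟫ : ℝ) * Complex.I := by push_cast; ring
    rw [h3]
    simp only [Complex.add_re, Complex.add_im, Complex.ofReal_re, Complex.ofReal_im,
      Complex.re_ofReal_mul, Complex.im_ofReal_mul, Complex.I_re, Complex.I_im]
    simp [mul_comm]
  · have h3 : ((π : ℂ) / δ) ^ ((Module.finrank ℝ (EE d) : ℂ) / 2) =
        (((π / δ) ^ ((d : ℝ) / 2) : ℝ) : ℂ) := by
      rw [Complex.ofReal_cpow (by positivity)]
      simp
    have h4 : Complex.I ^ 2 * (‖x‖ : ℂ) ^ 2 / (4 * δ) = ((-‖x‖ ^ 2 / (4 * δ) : ℝ) : ℂ) := by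
      push_cast; simp
    rw [h3, h4, ← Complex.ofReal_exp, ← Complex.ofReal_mul, RCLike.re_eq_complex_re, Complex.ofReal_re]

/-- Bounded functions whose product with every Gaussian has a nonnegative Fourier transform. -/
def GP {d : ℕ} (f : EE d → ℝ) : Prop :=
  Measurable f ∧ (∀ ξ, |f ξ| ≤ 1) ∧ ∀ δ > 0, ∀ x : EE d,
    0 ≤ ∫ ξ, Real.cos ⟪x, ξ⟫ * (f ξ * Real.exp (-δ * ‖ξ‖ ^ 2))

theorem GP.one {d : ℕ} : GP (fun _ : EE d => 1) := by
  refine ⟨measurable_const, by simp, fun δ hδ x => ?_⟩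
  simp only [one_mul]
  rw [gauss_cos hδ]
  positivity

theorem GP.integrand_bound {f : ℝ} (hf : |f| ≤ 1) (c e : ℝ) (he : 0 ≤ e) :
    ‖Real.cos c * (f * e)‖ ≤ e := by
  rw [norm_mul, norm_mul, Real.norm_eq_abs, Real.norm_eq_abs, Real.norm_of_nonneg he]
  have := Real.abs_cos_le_one c
  calc _ ≤ 1 * (1 * e) := by gcongr
    _ = e := by ring

theorem GP.integrable {d : ℕ} {f : EE d → ℝ} (hm : Measurable f) (hb : ∀ ξ, |f ξ| ≤ 1) {δ : ℝ}
    (hδ : 0 < δ) (x : EE d) :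
    Integrable (fun ξ => Real.cos ⟪x, ξ⟫ * (f ξ * Real.exp (-δ * ‖ξ‖ ^ 2))) := by
  refine (gauss_int hδ).mono' ?_ (Eventually.of_forall fun ξ => GP.integrand_bound (hb ξ) _ _ (by positivity))
  exact (by fun_prop : Measurable _).aestronglyMeasurable

theorem GP.limit {d : ℕ} {f : ℕ → EE d → ℝ} {g : EE d → ℝ} (hm : Measurable g)
    (hmf : ∀ n, Measurable (f n)) (hb : ∀ n ξ, |f n ξ| ≤ 1)
    (hf : ∀ n, ∀ δ > 0, ∀ x : EE d,
      0 ≤ ∫ ξ, Real.cos ⟪x, ξ⟫ * (f n ξ * Real.exp (-δ * ‖ξ‖ ^ 2)))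
    (hbg : ∀ ξ, |g ξ| ≤ 1)
    (h : ∀ᵐ ξ, Tendsto (fun n => f n ξ) atTop (nhds (g ξ))) : GP g := by
  refine ⟨hm, hbg, fun δ hδ x => ?_⟩
  refine ge_of_tendsto' (tendsto_integral_of_dominated_convergence
    (fun ξ => Real.exp (-δ * ‖ξ‖ ^ 2)) (fun n => (GP.integrable (hmf n) (hb n) hδ x).1) (gauss_int hδ)
    (fun n => Eventually.of_forall fun ξ => GP.integrand_bound (hb n ξ) _ _ (by positivity)) ?_)
    (fun n => hf n δ hδ x)
  filter_upwards [h] with ξ hξ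
  exact (hξ.mul_const _).const_mul _

theorem GP.mul_sibuya {d : ℕ} (hd : 1 ≤ d) {β : ℝ} (h0 : 0 < β) (h1 : β < 1) {l : ℝ} (hl : 0 < l)
    {f : EE d → ℝ} (hf : GP f) :
    GP (fun ξ => f ξ * (1 - (1 - Real.exp (-l * ‖ξ‖ ^ 2)) ^ β)) := by
  obtain ⟨a, ha, hs⟩ := sibuya h0 h1
  have key : ∀ z : ℝ, 0 ≤ z → z ≤ 1 → 0 ≤ 1 - (1 - z) ^ β ∧ 1 - (1 - z) ^ β ≤ 1 := by
    intro z hz hz1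
    constructor
    · linarith [Real.rpow_le_one (x := 1 - z) (z := β) (by linarith) (by linarith) h0.le]
    · linarith [Real.rpow_nonneg (x := 1 - z) (by linarith) β]
  have he : ∀ ξ : EE d, Real.exp (-l * ‖ξ‖ ^ 2) ≤ 1 := fun ξ => by
    rw [Real.exp_le_one_iff]; nlinarith [sq_nonneg ‖ξ‖]
  have habs : ∀ u v : ℝ, |u| ≤ 1 → 0 ≤ v → v ≤ 1 → |u * v| ≤ 1 := by
    intro u v hu hv hv1
    rw [abs_mul, abs_of_nonneg hv]
    calc _ ≤ (1:ℝ) * 1 := by gcongr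
      _ = 1 := one_mul 1
  obtain ⟨hm, hb, hp⟩ := hf
  have hpart1 : ∀ z : ℝ, 0 ≤ z → z < 1 → ∀ n, ∑ k ∈ Finset.range n, a k * z ^ k ≤ 1 := by
    intro z hz hz1 n
    refine (sum_le_hasSum _ (fun i _ => ?_) (hs z hz hz1)).trans (key z hz hz1.le).2
    exact mul_nonneg (ha i) (pow_nonneg hz i)
  have hpart : ∀ z : ℝ, 0 ≤ z → z ≤ 1 → ∀ n, ∑ k ∈ Finset.range n, a k * z ^ k ≤ 1 := by
    intro z hz hz1 n
    have hc : Continuous fun z : ℝ => ∑ k ∈ Finset.range n, a k * z ^ k := by fun_prop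
    have : ∑ k ∈ Finset.range n, a k * (1:ℝ) ^ k ≤ 1 := by
      have ht : Tendsto (fun z : ℝ => ∑ k ∈ Finset.range n, a k * z ^ k) (nhdsWithin 1 (Set.Ioo 0 1))
        (nhds (∑ k ∈ Finset.range n, a k * (1:ℝ) ^ k)) := (hc.tendsto 1).mono_left nhdsWithin_le_nhds
      have : (nhdsWithin (1:ℝ) (Set.Ioo 0 1)).NeBot := by
        rw [← mem_closure_iff_nhdsWithin_neBot, closure_Ioo (by norm_num)]; simp
      refine le_of_tendsto ht ?_
      filter_upwards [self_mem_nhdsWithin] with z hz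
      exact hpart1 z hz.1.le hz.2 n
    refine le_trans (Finset.sum_le_sum fun k _ => ?_) this
    have := ha k
    gcongr
  refine GP.limit (f := fun n ξ => f ξ * ∑ k ∈ Finset.range n, a k * Real.exp (-l * ‖ξ‖ ^ 2) ^ k)
    (by fun_prop) (fun n => by fun_prop) ?_ ?_ ?_ ?_
  · intro n ξ
    refine habs _ _ (hb ξ) (Finset.sum_nonneg fun k _ => mul_nonneg (ha k) (by positivity)) ?_
    exact hpart _ (by positivity) (he ξ) n
  · intro n δ hδ x
    have : ∀ ξ : EE d, Real.cos ⟪x, ξ⟫ * (f ξ * (∑ k ∈ Finset.range n, a k * Real.exp (-l * ‖ξ‖ ^ 2) ^ k) * Real.exp (-δ * ‖ξ‖ ^ 2))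
      = ∑ k ∈ Finset.range n, a k * (Real.cos ⟪x, ξ⟫ * (f ξ * Real.exp (-(δ + k * l) * ‖ξ‖ ^ 2))) := by
      intro ξ
      rw [Finset.mul_sum, Finset.sum_mul, Finset.mul_sum]
      refine Finset.sum_congr rfl fun k _ => ?_
      have : Real.exp (-(δ + k * l) * ‖ξ‖ ^ 2) = Real.exp (-l * ‖ξ‖ ^ 2) ^ k * Real.exp (-δ * ‖ξ‖ ^ 2) := by
        rw [← Real.exp_nat_mul, ← Real.exp_add]; congr 1; ring
      rw [this]; ring
    simp_rw [this]
    rw [integral_finsetSum _ (fun k _ => (GP.integrable hm hb (by positivity) x).const_mul _)]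
    refine Finset.sum_nonneg fun k _ => ?_
    rw [integral_const_mul]
    exact mul_nonneg (ha k) (hp _ (by positivity) x)
  · intro ξ
    have := key _ (by positivity) (he ξ)
    exact habs _ _ (hb ξ) this.1 this.2
  · have : Nonempty (Fin d) := ⟨⟨0, hd⟩⟩
    have : ∀ᵐ ξ : EE d, ξ ≠ 0 := by simp [ae_iff]
    filter_upwards [this] with ξ hξ
    refine Tendsto.const_mul _ ((hs _ (by positivity) ?_).tendsto_sum_nat)
    rw [Real.exp_lt_one_iff]
    have : 0 < ‖ξ‖ := norm_pos_iff.2 hξ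
    have : 0 < l * ‖ξ‖ ^ 2 := by positivity
    linarith

theorem GP.exp {d : ℕ} (hd : 1 ≤ d) {α : ℝ} (h0 : 0 < α) (h2 : α < 2) :
    GP (fun ξ : EE d => Real.exp (-‖ξ‖ ^ α)) := by
  set β := α / 2 with hβ
  have hb0 : 0 < β := by positivity
  have hb1 : β < 1 := by linarith
  have hpow : ∀ {l : ℝ}, 0 < l → ∀ n : ℕ, GP (fun ξ : EE d => (1 - (1 - Real.exp (-l * ‖ξ‖ ^ 2)) ^ β) ^ n) := by
    intro l hl n
    induction n with
    | zero => simpa using GP.one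
    | succ n ih =>
      simp_rw [pow_succ]
      exact GP.mul_sibuya hd hb0 hb1 hl ih
  set l : ℕ → ℝ := fun n => ((n : ℝ) + 1) ^ (-(1 / β)) with hl
  have hlpos : ∀ n, 0 < l n := fun n => by positivity
  have hlim0 : Tendsto l atTop (nhds 0) :=
    (tendsto_rpow_neg_atTop (by positivity : 0 < 1 / β)).comp
      (tendsto_atTop_add_const_right _ _ tendsto_natCast_atTop_atTop)
  refine GP.limit (f := fun n ξ => (1 - (1 - Real.exp (-l n * ‖ξ‖ ^ 2)) ^ β) ^ n) (by fun_prop)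
    (fun n => (hpow (hlpos n) n).1) (fun n => (hpow (hlpos n) n).2.1)
    (fun n => (hpow (hlpos n) n).2.2) ?_ ?_
  · intro ξ
    rw [abs_of_nonneg (by positivity), Real.exp_le_one_iff]
    have : 0 ≤ ‖ξ‖ ^ α := by positivity
    linarith
  · refine Eventually.of_forall fun ξ => ?_
    simp_rw [sub_eq_add_neg (1 : ℝ) (_ ^ β)]
    apply Real.tendsto_one_add_pow_exp_of_tendsto
    simp_rw [mul_neg]
    apply Tendsto.neg
    set r := ‖ξ‖ ^ 2 with hr
    have hr0 : 0 ≤ r := by positivity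
    -- (1 - exp (-l r)) / l → r
    have hd1 : Tendsto (fun n => (l n)⁻¹ * (1 - Real.exp (-l n * r))) atTop (nhds r) := by
      have hder : HasDerivAt (fun s : ℝ => 1 - Real.exp (-s * r)) r 0 := by
        have := (((hasDerivAt_id (0:ℝ)).neg.mul_const r).exp).const_sub 1
        simpa using this
      have := hder.tendsto_slope_zero.comp (tendsto_nhdsWithin_iff.2 ⟨hlim0, Eventually.of_forall fun n => (hlpos n).ne'⟩)
      simpa [Function.comp_def] using this
    have hd2 := (hd1.rpow_const (p := β) (Or.inr hb0.le))
    have hn : Tendsto (fun n : ℕ => (n : ℝ) / (n + 1)) atTop (nhds 1) := tendsto_natCast_div_add_atTop 1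
    have hd3 := hn.mul hd2
    have hfin : 1 * r ^ β = ‖ξ‖ ^ α := by
      rw [one_mul, hr, ← Real.rpow_natCast, ← Real.rpow_mul (norm_nonneg _)]
      congr 1
      rw [hβ]; push_cast; ring
    rw [hfin] at hd3
    refine hd3.congr fun n => ?_
    have hnn : 0 ≤ 1 - Real.exp (-l n * r) := by
      have : Real.exp (-l n * r) ≤ 1 := by rw [Real.exp_le_one_iff]; nlinarith [hlpos n]
      linarith
    rw [Real.mul_rpow (inv_nonneg.2 (hlpos n).le) hnn]
    have : ((l n)⁻¹) ^ β = n + 1 := by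
      rw [hl]
      simp only
      rw [← Real.rpow_neg (by positivity), ← Real.rpow_mul (by positivity)]
      have : - -(1 / β) * β = 1 := by field_simp
      rw [this, Real.rpow_one]
    rw [this]
    field_simp

theorem exp_rpow_int {d : ℕ} {α : ℝ} (hα : 1 < α) :
    Integrable (fun ξ : EE d => Real.exp (-‖ξ‖ ^ α)) := by
  have h1 : Integrable (fun ξ : EE d => (1 + ‖ξ‖) ^ (-((d : ℝ) + 1))) :=
    integrable_one_add_norm (by simp)
  -- e^{-s} (1+s)^{d+1} bounded on s ≥ 0
  obtain ⟨C, hC⟩ : ∃ C : ℝ, ∀ s : ℝ, 0 ≤ s → Real.exp (-s) ≤ C * (1 + s) ^ (-((d : ℝ) + 1)) := by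
    refine ⟨((d + 1).factorial : ℝ) * Real.exp 1, fun s hs => ?_⟩
    have h := Real.pow_div_factorial_le_exp (x := 1 + s) (by linarith) (d + 1)
    have hp : (1 + s) ^ (-((d : ℝ) + 1)) = ((1 + s) ^ (d + 1))⁻¹ := by
      rw [Real.rpow_neg (by linarith), ← Real.rpow_natCast]; push_cast; rfl
    rw [hp, Real.exp_neg, ← div_eq_mul_inv, le_div_iff₀ (by positivity)]
    rw [div_le_iff₀ (by positivity), Real.exp_add] at h
    have : 0 < Real.exp s := Real.exp_pos s
    rw [inv_mul_le_iff₀ this]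
    linarith
  refine (h1.const_mul (Real.exp 1 * C)).mono'
    (by fun_prop : Measurable _).aestronglyMeasurable (Eventually.of_forall fun ξ => ?_)
  rw [Real.norm_of_nonneg (by positivity)]
  have h2 : ‖ξ‖ - 1 ≤ ‖ξ‖ ^ α := by
    rcases le_total ‖ξ‖ 1 with h | h
    · have : 0 ≤ ‖ξ‖ ^ α := by positivity
      linarith
    · have := Real.rpow_le_rpow_of_exponent_le h hα.le
      rw [Real.rpow_one] at this
      linarith
  calc Real.exp (-‖ξ‖ ^ α) ≤ Real.exp (1 + -‖ξ‖) := by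
        apply Real.exp_le_exp.2; linarith
    _ = Real.exp 1 * Real.exp (-‖ξ‖) := Real.exp_add _ _
    _ ≤ Real.exp 1 * (C * (1 + ‖ξ‖) ^ (-((d : ℝ) + 1))) := by
        gcongr; exact hC _ (norm_nonneg _)
    _ = _ := by ring

/-- The kernel at time one. -/
noncomputable def KK (d : ℕ) (α : ℝ) (x : EE d) : ℝ :=
  (2 * Real.pi) ^ (-(d : ℝ)) * ∫ ξ : EE d, Real.cos ⟪x, ξ⟫ * Real.exp (-‖ξ‖ ^ α)

theorem heatKer_scale {d : ℕ} {α : ℝ} (hα : 0 < α) {t : ℝ} (ht : 0 < t) (x : EE d) :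
    heatKer d α t x = (t ^ (-(1 / α))) ^ d * KK d α (t ^ (-(1 / α)) • x) := by
  unfold heatKer KK
  set R := t ^ (1 / α) with hR
  have hRpos : 0 < R := by positivity
  have hs : t ^ (-(1 / α)) = R⁻¹ := Real.rpow_neg ht.le _
  rw [hs]
  have h := Measure.integral_comp_smul (volume : Measure (EE d))
    (fun η : EE d => Real.cos ⟪R⁻¹ • x, η⟫ * Real.exp (-‖η‖ ^ α)) R
  have h2 : ∀ ξ : EE d, Real.cos ⟪x, ξ⟫ * Real.exp (-t * ‖ξ‖ ^ α) =
      Real.cos ⟪R⁻¹ • x, R • ξ⟫ * Real.exp (-‖R • ξ‖ ^ α) := by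
    intro ξ
    rw [real_inner_smul_left, real_inner_smul_right, norm_smul, Real.norm_of_nonneg hRpos.le,
      Real.mul_rpow hRpos.le (norm_nonneg _), hR, ← Real.rpow_mul ht.le, ← mul_assoc,
      inv_mul_cancel₀ (by positivity), one_mul]
    congr 2
    rw [one_div, inv_mul_cancel₀ hα.ne', Real.rpow_one]; ring
  simp_rw [h2]
  rw [h, abs_of_nonneg (by positivity), smul_eq_mul]
  simp
  ring

theorem KK_int {d : ℕ} {α : ℝ} (hα : 1 < α) (x : EE d) :
    Integrable (fun ξ : EE d => Real.cos ⟪x, ξ⟫ * Real.exp (-‖ξ‖ ^ α)) := by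
  refine (exp_rpow_int (d := d) hα).mono' (by fun_prop) (Eventually.of_forall fun ξ => ?_)
  rw [norm_mul, Real.norm_of_nonneg (Real.exp_pos _).le]
  exact mul_le_of_le_one_left (Real.exp_pos _).le (Real.abs_cos_le_one _)

theorem KK_nonneg {d : ℕ} (hd : 1 ≤ d) {α : ℝ} (hα : 1 < α) (h2 : α < 2) (x : EE d) :
    0 ≤ KK d α x := by
  obtain ⟨hm, hb, hp⟩ := GP.exp hd (by linarith : 0 < α) h2
  unfold KK
  refine mul_nonneg (by positivity) ?_
  have hlim : Tendsto (fun n : ℕ => 1 / ((n : ℝ) + 1)) atTop (nhds 0) := tendsto_one_div_add_atTop_nhds_zero_nat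
  refine ge_of_tendsto' (tendsto_integral_of_dominated_convergence
    (F := fun (n : ℕ) ξ => Real.cos ⟪x, ξ⟫ * (Real.exp (-‖ξ‖ ^ α) * Real.exp (-(1 / ((n : ℝ) + 1)) * ‖ξ‖ ^ 2)))
    (fun ξ => Real.exp (-‖ξ‖ ^ α)) (fun n => by fun_prop) (exp_rpow_int hα) ?_ ?_)
    (fun n => hp _ (by positivity) x)
  · refine fun n => Eventually.of_forall fun ξ => ?_
    rw [mul_comm (Real.exp (-‖ξ‖ ^ α))]
    refine GP.integrand_bound ?_ _ _ (Real.exp_pos _).le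
    rw [abs_of_nonneg (Real.exp_pos _).le, Real.exp_le_one_iff]
    have : 0 ≤ 1 / ((n : ℝ) + 1) * ‖ξ‖ ^ 2 := by positivity
    linarith
  · refine Eventually.of_forall fun ξ => ?_
    have : Tendsto (fun n : ℕ => Real.exp (-(1 / ((n : ℝ) + 1)) * ‖ξ‖ ^ 2)) atTop (nhds (Real.exp (-0 * ‖ξ‖ ^ 2))) :=
      (Real.continuous_exp.tendsto _).comp (hlim.neg.mul_const _)
    have h3 := (this.const_mul (Real.exp (-‖ξ‖ ^ α))).const_mul (Real.cos ⟪x, ξ⟫)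
    simpa using h3

/-- Modulus of continuity. -/
noncomputable def WW (d : ℕ) (α : ℝ) (h : EE d) : ℝ :=
  (2 * Real.pi) ^ (-(d : ℝ)) * ∫ ξ : EE d, min 2 |⟪h, ξ⟫| * Real.exp (-‖ξ‖ ^ α)

theorem WW_int {d : ℕ} {α : ℝ} (hα : 1 < α) (h : EE d) :
    Integrable (fun ξ : EE d => min 2 |⟪h, ξ⟫| * Real.exp (-‖ξ‖ ^ α)) := by
  refine ((exp_rpow_int (d := d) hα).const_mul 2).mono' (by fun_prop) (Eventually.of_forall fun ξ => ?_)
  rw [Real.norm_of_nonneg (by positivity)]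
  gcongr
  exact min_le_left _ _

theorem WW_cont {d : ℕ} {α : ℝ} (hα : 1 < α) : Continuous (WW d α) := by
  unfold WW
  refine continuous_const.mul ?_
  refine continuous_of_dominated (bound := fun ξ => 2 * Real.exp (-‖ξ‖ ^ α)) (fun h => (WW_int hα h).1)
    (fun h => Eventually.of_forall fun ξ => ?_) ((exp_rpow_int hα).const_mul 2)
    (Eventually.of_forall fun ξ => by fun_prop)
  rw [Real.norm_of_nonneg (by positivity)]
  gcongr
  exact min_le_left _ _

theorem WW_zero {d : ℕ} {α : ℝ} : WW d α 0 = 0 := by simp [WW]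

theorem WW_nonneg {d : ℕ} {α : ℝ} (h : EE d) : 0 ≤ WW d α h := by
  unfold WW
  exact mul_nonneg (by positivity) (integral_nonneg fun ξ => by positivity)

theorem WW_le {d : ℕ} {α : ℝ} (hα : 1 < α) : ∃ C, ∀ h, WW d α h ≤ C := by
  refine ⟨(2 * Real.pi) ^ (-(d : ℝ)) * ∫ ξ : EE d, 2 * Real.exp (-‖ξ‖ ^ α), fun h => ?_⟩
  unfold WW
  gcongr
  · exact WW_int hα h
  · exact (exp_rpow_int hα).const_mul 2
  · intro ξ
    simp only
    gcongr
    exact min_le_left _ _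

theorem KK_diff {d : ℕ} {α : ℝ} (hα : 1 < α) (z h : EE d) : |KK d α (z - h) - KK d α z| ≤ WW d α h := by
  unfold KK WW
  rw [← mul_sub, abs_mul, abs_of_nonneg (by positivity : 0 ≤ (2 * Real.pi) ^ (-(d : ℝ))),
    ← integral_sub (KK_int hα _) (KK_int hα _)]
  gcongr
  rw [← Real.norm_eq_abs]
  refine norm_integral_le_of_norm_le (WW_int hα h) (Eventually.of_forall fun ξ => ?_)
  rw [← sub_mul, norm_mul, Real.norm_of_nonneg (Real.exp_pos _).le]
  gcongr
  rw [Real.norm_eq_abs]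
  refine le_min ?_ ?_
  · have := Real.abs_cos_le_one ⟪z - h, ξ⟫
    have := Real.abs_cos_le_one ⟪z, ξ⟫
    refine (abs_sub _ _).trans ?_
    linarith
  · have h1 := Real.abs_cos_sub_cos_le ⟪z - h, ξ⟫ ⟪z, ξ⟫
    rw [inner_sub_left] at h1 ⊢
    simpa using h1

theorem KK_cont {d : ℕ} {α : ℝ} (hα : 1 < α) : Continuous (KK d α) := by
  unfold KK
  refine continuous_const.mul ?_
  refine continuous_of_dominated (bound := fun ξ => Real.exp (-‖ξ‖ ^ α)) (fun h => (KK_int hα h).1)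
    (fun h => Eventually.of_forall fun ξ => ?_) (exp_rpow_int hα)
    (Eventually.of_forall fun ξ => by fun_prop)
  rw [norm_mul, Real.norm_of_nonneg (Real.exp_pos _).le]
  exact mul_le_of_le_one_left (Real.exp_pos _).le (Real.abs_cos_le_one _)

theorem KK_bdd {d : ℕ} {α : ℝ} (hα : 1 < α) : ∃ C, ∀ z, |KK d α z| ≤ C := by
  obtain ⟨C, hC⟩ := WW_le (d := d) hα
  refine ⟨|KK d α 0| + C, fun z => ?_⟩
  have := KK_diff hα 0 (-z)
  have h2 := abs_sub_abs_le_abs_sub (KK d α (0 - -z)) (KK d α 0)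
  have h3 := hC (-z)
  simp only [sub_neg_eq_add, zero_add] at *
  linarith

theorem KK_gauss {d : ℕ} {α : ℝ} (hα : 1 < α) {ε : ℝ} (hε : 0 < ε) :
    ∫ x, KK d α x * Real.exp (-ε * ‖x‖ ^ 2) ≤
      (2 * Real.pi) ^ (-(d : ℝ)) * (4 * π ^ 2) ^ ((d : ℝ) / 2) := by
  unfold KK
  simp_rw [mul_assoc]
  rw [integral_const_mul]
  gcongr
  simp_rw [← integral_mul_const]
  have hint : Integrable (Function.uncurry fun (x ξ : EE d) =>
      Real.cos ⟪x, ξ⟫ * Real.exp (-‖ξ‖ ^ α) * Real.exp (-ε * ‖x‖ ^ 2)) (volume.prod volume) := by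
    refine ((gauss_int (d := d) hε).mul_prod (exp_rpow_int (d := d) hα)).mono'
      (by unfold Function.uncurry; fun_prop) (Eventually.of_forall fun ⟨x, ξ⟩ => ?_)
    simp only [Function.uncurry]
    rw [norm_mul, norm_mul, Real.norm_of_nonneg (Real.exp_pos _).le, Real.norm_of_nonneg (Real.exp_pos _).le, mul_comm]
    gcongr
    exact mul_le_of_le_one_left (Real.exp_pos _).le (Real.abs_cos_le_one _)
  rw [integral_integral_swap hint]
  have h1 : ∀ ξ : EE d, ∫ x : EE d, Real.cos ⟪x, ξ⟫ * Real.exp (-‖ξ‖ ^ α) * Real.exp (-ε * ‖x‖ ^ 2)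
      = Real.exp (-‖ξ‖ ^ α) * ((π / ε) ^ ((d : ℝ) / 2) * Real.exp (-(1 / (4 * ε)) * ‖ξ‖ ^ 2)) := by
    intro ξ
    have := gauss_cos hε ξ
    rw [show -(1 / (4 * ε)) * ‖ξ‖ ^ 2 = -‖ξ‖ ^ 2 / (4 * ε) by ring, ← this, ← integral_const_mul]
    refine integral_congr_ae (Eventually.of_forall fun x => ?_)
    simp only [real_inner_comm]
    ring
  simp_rw [h1]
  have hg : 0 < 1 / (4 * ε) := by positivity
  calc _ ≤ ∫ ξ : EE d, (π / ε) ^ ((d : ℝ) / 2) * Real.exp (-(1 / (4 * ε)) * ‖ξ‖ ^ 2) := by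
        refine integral_mono_of_nonneg (Eventually.of_forall fun ξ => by positivity) ((gauss_int hg).const_mul _)
          (Eventually.of_forall fun ξ => ?_)
        refine mul_le_of_le_one_left (by positivity) ?_
        rw [Real.exp_le_one_iff]
        have : 0 ≤ ‖ξ‖ ^ α := by positivity
        linarith
    _ = (4 * π ^ 2) ^ ((d : ℝ) / 2) := by
        rw [integral_const_mul, GaussianFourier.integral_rexp_neg_mul_sq_norm hg, finrank_euclideanSpace_fin,
          ← Real.mul_rpow (by positivity) (by positivity)]
        congr 1
        field_simp
    _ ≤ _ := le_rfl

theorem KK_integrable {d : ℕ} (hd : 1 ≤ d) {α : ℝ} (hα : 1 < α) (h2 : α < 2) : Integrable (KK d α) := by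
  refine ⟨(KK_cont hα).aestronglyMeasurable, ?_⟩
  set C := (2 * Real.pi) ^ (-(d : ℝ)) * (4 * π ^ 2) ^ ((d : ℝ) / 2)
  have hcont := KK_cont (d := d) hα
  have hlim : Tendsto (fun n : ℕ => 1 / ((n : ℝ) + 1)) atTop (nhds 0) := tendsto_one_div_add_atTop_nhds_zero_nat
  have hbound : ∀ n : ℕ, ∫⁻ x, ENNReal.ofReal (KK d α x * Real.exp (-(1 / ((n : ℝ) + 1)) * ‖x‖ ^ 2)) ≤ ENNReal.ofReal C := by
    intro n
    have hn : 0 < 1 / ((n : ℝ) + 1) := by positivity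
    obtain ⟨B, hB⟩ := KK_bdd (d := d) hα
    rw [← ofReal_integral_eq_lintegral_ofReal]
    · exact ENNReal.ofReal_le_ofReal (KK_gauss hα hn)
    · refine ((gauss_int hn).const_mul B).mono' (by fun_prop) (Eventually.of_forall fun ξ => ?_)
      rw [norm_mul, Real.norm_of_nonneg (Real.exp_pos _).le]
      gcongr
      exact hB _
    · exact Eventually.of_forall fun x => mul_nonneg (KK_nonneg hd hα h2 x) (Real.exp_pos _).le
  have hfatou := lintegral_liminf_le (μ := (volume : Measure (EE d))) (u := atTop)
    (f := fun (n : ℕ) x => ENNReal.ofReal (KK d α x * Real.exp (-(1 / ((n : ℝ) + 1)) * ‖x‖ ^ 2)))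
    (fun n => by fun_prop)
  have h3 : ∀ x : EE d, liminf (fun n : ℕ => ENNReal.ofReal (KK d α x * Real.exp (-(1 / ((n : ℝ) + 1)) * ‖x‖ ^ 2))) atTop = ‖KK d α x‖ₑ := by
    intro x
    rw [Real.enorm_eq_ofReal (KK_nonneg hd hα h2 x)]
    apply Tendsto.liminf_eq
    apply ENNReal.tendsto_ofReal
    have : Tendsto (fun n : ℕ => Real.exp (-(1 / ((n : ℝ) + 1)) * ‖x‖ ^ 2)) atTop (nhds (Real.exp (-0 * ‖x‖ ^ 2))) :=
      (Real.continuous_exp.tendsto _).comp (hlim.neg.mul_const _)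
    simpa using this.const_mul (KK d α x)
  simp_rw [h3] at hfatou
  refine lt_of_le_of_lt (hfatou.trans ?_) (ENNReal.ofReal_lt_top (r := C))
  refine (liminf_le_liminf (v := fun _ => ENNReal.ofReal C) (Eventually.of_forall hbound)).trans ?_
  simp

/-- `L¹` modulus of continuity of the kernel. -/
noncomputable def NN (d : ℕ) (α : ℝ) (h : EE d) : ℝ :=
  2 * ∫ z : EE d, max (KK d α z - KK d α (z - h)) 0

theorem NN_bound {d : ℕ} (hd : 1 ≤ d) {α : ℝ} (hα : 1 < α) (h2 : α < 2) (z h : EE d) :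
    ‖max (KK d α z - KK d α (z - h)) 0‖ ≤ KK d α z := by
  have h3 := KK_nonneg hd hα h2 z
  have h4 := KK_nonneg hd hα h2 (z - h)
  rw [Real.norm_of_nonneg (le_max_right _ _)]
  exact max_le (by linarith) h3

theorem NN_int {d : ℕ} (hd : 1 ≤ d) {α : ℝ} (hα : 1 < α) (h2 : α < 2) (h : EE d) :
    Integrable (fun z => max (KK d α z - KK d α (z - h)) 0) := by
  have hc := KK_cont (d := d) hα
  exact (KK_integrable hd hα h2).mono' (by fun_prop)
    (Eventually.of_forall fun z => NN_bound hd hα h2 z h)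

theorem NN_cont {d : ℕ} (hd : 1 ≤ d) {α : ℝ} (hα : 1 < α) (h2 : α < 2) : Continuous (NN d α) := by
  have hc := KK_cont (d := d) hα
  unfold NN
  refine continuous_const.mul ?_
  exact continuous_of_dominated (bound := KK d α) (fun h => (NN_int hd hα h2 h).1)
    (fun h => Eventually.of_forall fun z => NN_bound hd hα h2 z h) (KK_integrable hd hα h2)
    (Eventually.of_forall fun z => by fun_prop)

theorem NN_zero {d : ℕ} {α : ℝ} : NN d α 0 = 0 := by simp [NN]

theorem NN_le {d : ℕ} (hd : 1 ≤ d) {α : ℝ} (hα : 1 < α) (h2 : α < 2) : ∃ C, ∀ h, NN d α h ≤ C := by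
  refine ⟨2 * ∫ z, KK d α z, fun h => ?_⟩
  unfold NN
  refine mul_le_mul_of_nonneg_left ?_ (by norm_num)
  refine integral_mono (NN_int hd hα h2 h) (KK_integrable hd hα h2) fun z => ?_
  exact (le_abs_self _).trans (NN_bound hd hα h2 z h)

theorem NN_eq {d : ℕ} (hd : 1 ≤ d) {α : ℝ} (hα : 1 < α) (h2 : α < 2) (h : EE d) :
    ∫ z, ‖KK d α (z - h) - KK d α z‖ = NN d α h := by
  have hK := KK_integrable hd hα h2
  have hKh : Integrable (fun z => KK d α (z - h)) := hK.comp_sub_right h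
  have h1 : ∀ z, ‖KK d α (z - h) - KK d α z‖ =
      2 * max (KK d α z - KK d α (z - h)) 0 + (KK d α (z - h) - KK d α z) := by
    intro z
    rw [Real.norm_eq_abs]
    rcases le_total (KK d α z - KK d α (z - h)) 0 with h3 | h3
    · rw [max_eq_right h3, abs_of_nonneg (by linarith)]; ring
    · rw [max_eq_left h3, abs_of_nonpos (by linarith)]; ring
  simp_rw [h1]
  have hsub : Integrable (fun z => KK d α (z - h) - KK d α z) := hKh.sub hK
  rw [integral_add ((NN_int hd hα h2 h).const_mul 2) hsub, integral_sub hKh hK,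
    integral_sub_right_eq_self (fun z => KK d α z) h, integral_const_mul]
  simp [NN]

theorem lint_scale {d : ℕ} {g : EE d → ℝ} (hg : Integrable g) {s : ℝ} (hs : 0 < s) :
    ∫⁻ x, ENNReal.ofReal (s ^ d) * ‖g (s • x)‖ₑ = ENNReal.ofReal (∫ z, ‖g z‖) := by
  rw [lintegral_const_mul' _ _ ENNReal.ofReal_ne_top,
    ← ofReal_integral_norm_eq_lintegral_enorm (hg.comp_smul hs.ne'),
    Measure.integral_comp_smul volume (fun z => ‖g z‖) s, ← ENNReal.ofReal_mul (by positivity)]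
  congr 1
  rw [abs_of_nonneg (by positivity), finrank_euclideanSpace_fin, smul_eq_mul, ← mul_assoc,
    mul_inv_cancel₀ (by positivity), one_mul]

theorem interp {X : Type*} [MeasurableSpace X] {μ : Measure X} {D : X → ℝ} {S A : ℝ≥0∞} (hS : S ≠ ∞)
    (h1 : ∀ x, ‖D x‖ₑ ≤ S) (h2 : ∫⁻ x, ‖D x‖ₑ ∂μ ≤ A) {p : ℝ≥0∞} (hp : 1 ≤ p) :
    eLpNorm D p μ ≤ S ^ (1 - 1 / p).toReal * A ^ (1 - (1 - 1 / p).toReal) := by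
  by_cases hpt : p = ∞
  · subst hpt
    simp only [one_div, ENNReal.inv_top, tsub_zero, ENNReal.toReal_one, ENNReal.rpow_one, sub_self,
      ENNReal.rpow_zero, mul_one, eLpNorm_exponent_top]
    exact eLpNormEssSup_le_of_ae_enorm_bound (Eventually.of_forall h1)
  · have hp0 : p ≠ 0 := (zero_lt_one.trans_le hp).ne'
    have hpr : 1 ≤ p.toReal := by
      have := (ENNReal.toReal_le_toReal ENNReal.one_ne_top hpt).2 hp
      simpa using this
    have hθ : (1 - 1 / p).toReal = 1 - 1 / p.toReal := by
      rw [ENNReal.toReal_sub_of_le _ ENNReal.one_ne_top]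
      · simp
      · rw [one_div]; exact ENNReal.inv_le_one.2 hp
    rw [hθ, eLpNorm_eq_lintegral_rpow_enorm_toReal hp0 hpt]
    have h3 : ∫⁻ x, ‖D x‖ₑ ^ p.toReal ∂μ ≤ S ^ (p.toReal - 1) * A := by
      calc _ ≤ ∫⁻ x, S ^ (p.toReal - 1) * ‖D x‖ₑ ∂μ := by
            refine lintegral_mono fun x => ?_
            calc ‖D x‖ₑ ^ p.toReal = ‖D x‖ₑ ^ (p.toReal - 1) * ‖D x‖ₑ := by
                  conv_rhs => rw [← ENNReal.rpow_one ‖D x‖ₑ, ← ENNReal.rpow_mul, one_mul]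
                  rw [← ENNReal.rpow_add_of_nonneg _ _ (by linarith) (by norm_num)]
                  congr 1; ring
              _ ≤ _ := by
                  gcongr
                  exact h1 x
        _ = S ^ (p.toReal - 1) * ∫⁻ x, ‖D x‖ₑ ∂μ := by
            rw [lintegral_const_mul']
            exact ENNReal.rpow_ne_top_of_nonneg (by linarith) hS
        _ ≤ _ := by gcongr
    calc _ ≤ (S ^ (p.toReal - 1) * A) ^ (1 / p.toReal) := by gcongr
      _ = _ := by
        rw [ENNReal.mul_rpow_of_nonneg _ _ (by positivity), ← ENNReal.rpow_mul]
        congr 2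
        · field_simp
        · ring

theorem tendsto_avg {d : ℕ} {α : ℝ} (hα : 0 < α) {u0 : EE d → ℝ} (hu : Integrable u0) {G : EE d → ℝ}
    (hG : Continuous G) (hG0 : G 0 = 0) (hb : ∃ C, ∀ h, G h ≤ C) :
    Tendsto (fun t : ℝ => ∫⁻ y, ‖u0 y‖ₑ * ENNReal.ofReal (G (t ^ (-(1 / α)) • y))) atTop (nhds 0) := by
  obtain ⟨C, hC⟩ := hb
  have hs : Tendsto (fun t : ℝ => t ^ (-(1 / α))) atTop (nhds 0) := tendsto_rpow_neg_atTop (by positivity)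
  have hum := hu.1.enorm
  have := tendsto_lintegral_filter_of_dominated_convergence' (μ := (volume : Measure (EE d)))
    (l := (atTop : Filter ℝ)) (F := fun (t : ℝ) y => ‖u0 y‖ₑ * ENNReal.ofReal (G (t ^ (-(1 / α)) • y))) (f := fun _ => 0)
    (fun y => ‖u0 y‖ₑ * ENNReal.ofReal C) (Eventually.of_forall fun t => ?_)
    (Eventually.of_forall fun t => Eventually.of_forall fun y => ?_) ?_ (Eventually.of_forall fun y => ?_)
  · simpa using this
  · exact hum.mul (by fun_prop)
  · gcongr
    exact hC _
  · rw [lintegral_mul_const' _ _ ENNReal.ofReal_ne_top]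
    exact ENNReal.mul_ne_top hu.2.ne ENNReal.ofReal_ne_top
  · have h1 : Tendsto (fun t : ℝ => G (t ^ (-(1 / α)) • y)) atTop (nhds 0) := by
      have := (hG.tendsto 0)
      rw [hG0] at this
      refine this.comp ?_
      simpa using hs.smul_const y
    have h2 := ENNReal.Tendsto.const_mul (a := ‖u0 y‖ₑ) (ENNReal.tendsto_ofReal h1) (Or.inr enorm_ne_top)
    simpa using h2

theorem D_bound {d : ℕ} {α : ℝ} (hα : 1 < α) {u0 : EE d → ℝ}
    (hu : Integrable u0) {t : ℝ} (ht : 0 < t) (x : EE d) :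
    ‖heatSg d α t u0 x - (∫ x, u0 x) * heatKer d α t x‖ₑ ≤
      ∫⁻ y, ENNReal.ofReal ((t ^ (-(1 / α))) ^ d) *
        ‖KK d α (t ^ (-(1 / α)) • x - t ^ (-(1 / α)) • y) - KK d α (t ^ (-(1 / α)) • x)‖ₑ * ‖u0 y‖ₑ := by
  have hα0 : 0 < α := by linarith
  set s := t ^ (-(1 / α)) with hs
  have hspos : 0 < s := by positivity
  obtain ⟨B, hB⟩ := KK_bdd (d := d) hα
  have hc := KK_cont (d := d) hα
  unfold heatSg
  simp_rw [heatKer_scale hα0 ht, ← hs]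
  have hi : Integrable (fun y => s ^ d * KK d α (s • (x - y)) * u0 y) := by
    refine hu.bdd_mul (c := s ^ d * B) (by fun_prop) (Eventually.of_forall fun y => ?_)
    rw [norm_mul, Real.norm_of_nonneg (by positivity)]
    gcongr
    exact hB _
  rw [mul_comm, ← integral_const_mul, ← integral_sub hi (hu.const_mul _)]
  refine (enorm_integral_le_lintegral_enorm _).trans (lintegral_mono fun y => le_of_eq ?_)
  rw [← sub_mul, ← mul_sub, enorm_mul, enorm_mul, Real.enorm_eq_ofReal (by positivity : 0 ≤ s ^ d), smul_sub]

/-- `lim_{t→∞} t^{d(1−1/p)/α} ‖P_t u₀ − M p(t,·)‖_p = 0` with `M = ∫ u₀`. -/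
theorem heatSg_asymptotics (d : ℕ) (hd : 1 ≤ d) (α : ℝ) (hα : α ∈ Set.Ioo (1:ℝ) 2)
    (u0 : EuclideanSpace ℝ (Fin d) → ℝ) (hu0int : Integrable u0)
    (M : ℝ) (hM : M = ∫ x, u0 x) (p : ℝ≥0∞) (hp : 1 ≤ p) :
    Tendsto (fun t : ℝ =>
        ENNReal.ofReal (t ^ ((d : ℝ) * (1 - 1/p).toReal / α)) *
          eLpNorm (fun x => heatSg d α t u0 x - M * heatKer d α t x) p volume)
      atTop (nhds 0) := by
  obtain ⟨h1, h2⟩ := hα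
  have hα0 : 0 < α := by linarith
  subst hM
  have hA := tendsto_avg hα0 hu0int (NN_cont hd h1 h2) NN_zero (NN_le hd h1 h2)
  have hB := tendsto_avg hα0 hu0int (WW_cont (d := d) h1) WW_zero (WW_le h1)
  have hAB := hA.add hB
  rw [add_zero] at hAB
  refine tendsto_of_tendsto_of_tendsto_of_le_of_le' tendsto_const_nhds hAB
    (Eventually.of_forall fun _ => zero_le) ?_
  filter_upwards [eventually_gt_atTop 0] with t ht
  have hD := D_bound h1 hu0int ht
  set s := t ^ (-(1 / α)) with hs
  have hspos : 0 < s := by positivity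
  set A := ∫⁻ y, ‖u0 y‖ₑ * ENNReal.ofReal (NN d α (s • y))
  set B := ∫⁻ y, ‖u0 y‖ₑ * ENNReal.ofReal (WW d α (s • y)) with hBdef
  set c := ENNReal.ofReal (s ^ d) with hcdef
  have hc0 : c ≠ 0 := by simp only [hcdef, ne_eq, ENNReal.ofReal_eq_zero, not_le]; positivity
  have hct : c ≠ ∞ := ENNReal.ofReal_ne_top
  have hBfin : B ≠ ∞ := by
    obtain ⟨C, hC⟩ := WW_le (d := d) h1
    have : B ≤ ∫⁻ y, ‖u0 y‖ₑ * ENNReal.ofReal C := by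
      refine lintegral_mono fun y => ?_
      simp only
      gcongr
      exact hC _
    refine ne_top_of_le_ne_top ?_ this
    rw [lintegral_mul_const' _ _ ENNReal.ofReal_ne_top]
    exact ENNReal.mul_ne_top hu0int.2.ne ENNReal.ofReal_ne_top
  have hsup : ∀ x, ‖heatSg d α t u0 x - (∫ x, u0 x) * heatKer d α t x‖ₑ ≤ c * B := by
    intro x
    refine (hD x).trans ?_
    rw [hBdef, ← lintegral_const_mul' _ _ hct]
    refine lintegral_mono fun y => ?_
    simp only
    rw [mul_assoc, mul_comm ‖u0 y‖ₑ]
    gcongr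
    rw [Real.enorm_eq_ofReal_abs]
    exact ENNReal.ofReal_le_ofReal (KK_diff h1 _ _)
  have hL1 : ∫⁻ x, ‖heatSg d α t u0 x - (∫ x, u0 x) * heatKer d α t x‖ₑ ≤ A := by
    refine (lintegral_mono hD).trans ?_
    have hcont := KK_cont (d := d) h1
    rw [lintegral_lintegral_swap]
    · refine lintegral_mono fun y => ?_
      simp only
      rw [lintegral_mul_const' _ _ enorm_ne_top, mul_comm]
      gcongr
      have hg : Integrable (fun z => KK d α (z - s • y) - KK d α z) :=
        ((KK_integrable hd h1 h2).comp_sub_right _).sub (KK_integrable hd h1 h2)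
      rw [lint_scale hg hspos, NN_eq hd h1 h2]
    · refine AEMeasurable.mul ?_ hu0int.1.enorm.comp_snd
      exact (by fun_prop : Measurable _).aemeasurable
  have hI := interp (ENNReal.mul_ne_top hct hBfin) hsup hL1 hp
  set θ := (1 - 1 / p).toReal with hθ
  have hθ0 : 0 ≤ θ := ENNReal.toReal_nonneg
  have hθ1 : θ ≤ 1 := by
    have := ENNReal.toReal_mono ENNReal.one_ne_top (tsub_le_self : 1 - 1 / p ≤ 1)
    rwa [ENNReal.toReal_one] at this
  have hpre : ENNReal.ofReal (t ^ ((d : ℝ) * θ / α)) * c ^ θ = 1 := by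
    rw [hcdef, ENNReal.ofReal_rpow_of_nonneg (by positivity) hθ0, ← ENNReal.ofReal_mul (by positivity),
      hs, ← Real.rpow_natCast, ← Real.rpow_mul ht.le, ← Real.rpow_mul ht.le, ← Real.rpow_add ht]
    have : (d : ℝ) * θ / α + -(1 / α) * d * θ = 0 := by ring
    rw [this]
    simp
  calc _ ≤ ENNReal.ofReal (t ^ ((d : ℝ) * θ / α)) * ((c * B) ^ θ * A ^ (1 - θ)) := by gcongr
    _ = B ^ θ * A ^ (1 - θ) := by
        rw [ENNReal.mul_rpow_of_nonneg _ _ hθ0, ← mul_assoc, ← mul_assoc, hpre, one_mul]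
    _ ≤ (A + B) ^ θ * (A + B) ^ (1 - θ) := by
        have : 0 ≤ 1 - θ := by linarith
        gcongr
        · exact le_add_self
        · exact le_self_add
    _ = A + B := by
        rw [← ENNReal.rpow_add_of_nonneg _ _ hθ0 (by linarith)]
        simp
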